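/- Let n be a positive integer and let p₀,…,pₙ ∈ ℝ^{1,n} be (n+1) points in general position. Then the Lorentzian distance-squared mapping L_{(p₀,…,pₙ)} is A-equivalent to the Euclidean distance-squared mapping D_{(p₀,…,pₙ)} if and only if the recognition subspace V(p₀,…,pₙ) is time-like or space-like. -/

import Mathlib

open scoped BigOperators

noncomputable section

/-- The Lorentzian inner product on `ℝ^{1,n}`, modeled as `Fin (n+1) → ℝ`:
`⟨x,y⟩ = -x₀y₀ + x₁y₁ + ⋯ + xₙyₙ`. -/
def lorIP {n : ℕ} (x y : Fin (n + 1) → ℝ) : ℝ :=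
  (∑ i, x i * y i) - 2 * (x 0 * y 0)

/-- The Euclidean inner product on `Fin m → ℝ`. -/
def eucIP {m : ℕ} (x y : Fin m → ℝ) : ℝ := ∑ i, x i * y i

/-- The Lorentzian distance-squared mapping determined by the points `p 0, …, p (m-1)`. -/
def LorDSM {n m : ℕ} (p : Fin m → Fin (n + 1) → ℝ) :
    (Fin (n + 1) → ℝ) → (Fin m → ℝ) :=
  fun x i => lorIP (x - p i) (x - p i)

/-- The Euclidean distance-squared mapping determined by the points `p 0, …, p (m-1)`. -/
def EucDSM {n m : ℕ} (p : Fin m → Fin (n + 1) → ℝ) :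
    (Fin (n + 1) → ℝ) → (Fin m → ℝ) :=
  fun x i => eucIP (x - p i) (x - p i)

/-- The recognition subspace `V(p₀, …, p_k)`: the span of the vectors `p i - p 0`. -/
def recSub {n k : ℕ} (p : Fin (k + 1) → Fin (n + 1) → ℝ) :
    Submodule ℝ (Fin (n + 1) → ℝ) :=
  Submodule.span ℝ (Set.range fun i => p i - p 0)

/-- The partial recognition subspace `V(p₀, …, p_j)`: the span of `p i - p 0` for `i ≤ j`. -/
def recSubUpTo {n k : ℕ} (p : Fin (k + 1) → Fin (n + 1) → ℝ) (j : ℕ) :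
    Submodule ℝ (Fin (n + 1) → ℝ) :=
  Submodule.span ℝ {v | ∃ i : Fin (k + 1), (i : ℕ) ≤ j ∧ v = p i - p 0}

/-- A subspace is time-like iff it contains a vector of negative Lorentzian square. -/
def LTimeLike {n : ℕ} (V : Submodule ℝ (Fin (n + 1) → ℝ)) : Prop :=
  ∃ v ∈ V, lorIP v v < 0

/-- A subspace is space-like iff every nonzero vector in it has positive Lorentzian square. -/
def LSpaceLike {n : ℕ} (V : Submodule ℝ (Fin (n + 1) → ℝ)) : Prop :=
  ∀ v ∈ V, v ≠ 0 → 0 < lorIP v v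

/-- A subspace is light-like iff it is neither time-like nor space-like. -/
def LLightLike {n : ℕ} (V : Submodule ℝ (Fin (n + 1) → ℝ)) : Prop :=
  ¬ LTimeLike V ∧ ¬ LSpaceLike V

/-- `f` and `g` are `𝒜`-equivalent: `g = H ∘ f ∘ h` for `C^∞` diffeomorphisms `h, H`. -/
def AEquiv {a b : ℕ} (f g : (Fin a → ℝ) → (Fin b → ℝ)) : Prop :=
  ∃ (h : (Fin a → ℝ) ≃ (Fin a → ℝ)) (H : (Fin b → ℝ) ≃ (Fin b → ℝ)),
    ContDiff ℝ (⊤ : ℕ∞) ⇑h ∧ ContDiff ℝ (⊤ : ℕ∞) ⇑h.symm ∧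
    ContDiff ℝ (⊤ : ℕ∞) ⇑H ∧ ContDiff ℝ (⊤ : ℕ∞) ⇑H.symm ∧
    g = ⇑H ∘ f ∘ ⇑h

/-- The Lorentzian inner product as a bilinear form. -/
def lorForm (n : ℕ) : LinearMap.BilinForm ℝ (Fin (n + 1) → ℝ) :=
  LinearMap.mk₂ ℝ lorIP
    (fun x y z => by simp only [lorIP, Pi.add_apply, add_mul, Finset.sum_add_distrib]; ring)
    (fun c x y => by
      simp only [lorIP, Pi.smul_apply, smul_eq_mul, mul_assoc, ← Finset.mul_sum]; ring)
    (fun x y z => by simp only [lorIP, Pi.add_apply, mul_add, Finset.sum_add_distrib]; ring)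
    (fun c x y => by
      simp only [lorIP, Pi.smul_apply, smul_eq_mul, mul_left_comm _ c, ← Finset.mul_sum]; ring)

/-- The Euclidean inner product as a bilinear form. -/
def eucForm (m : ℕ) : LinearMap.BilinForm ℝ (Fin m → ℝ) :=
  LinearMap.mk₂ ℝ eucIP
    (fun x y z => by simp only [eucIP, Pi.add_apply, add_mul, Finset.sum_add_distrib])
    (fun c x y => by
      simp only [eucIP, Pi.smul_apply, smul_eq_mul, mul_assoc, ← Finset.mul_sum])
    (fun x y z => by simp only [eucIP, Pi.add_apply, mul_add, Finset.sum_add_distrib])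
    (fun c x y => by
      simp only [eucIP, Pi.smul_apply, smul_eq_mul, mul_left_comm _ c, ← Finset.mul_sum])

lemma lorForm_apply {n : ℕ} (x y : Fin (n + 1) → ℝ) : lorForm n x y = lorIP x y := rfl

lemma lorIP_comm {n : ℕ} (x y : Fin (n + 1) → ℝ) : lorIP x y = lorIP y x := by
  simp only [lorIP, mul_comm]

lemma eucIP_comm {m : ℕ} (x y : Fin m → ℝ) : eucIP x y = eucIP y x := by
  simp only [eucIP, mul_comm]

lemma eucIP_self_eq_zero {m : ℕ} {x : Fin m → ℝ} (h : eucIP x x = 0) : x = 0 := by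
  funext i
  have := (Finset.sum_eq_zero_iff_of_nonneg (fun i _ => mul_self_nonneg (x i))).1 h i
    (Finset.mem_univ i)
  simpa using this

lemma lorIP_eq_sum_succ {n : ℕ} (x y : Fin (n + 1) → ℝ) :
    lorIP x y = (∑ i : Fin n, x i.succ * y i.succ) - x 0 * y 0 := by
  rw [lorIP, Fin.sum_univ_succ]; ring

lemma eq_zero_of_forall_lorIP_eq_zero {n : ℕ} {y : Fin (n + 1) → ℝ}
    (h : ∀ x, lorIP x y = 0) : y = 0 := by
  apply eucIP_self_eq_zero
  have := h (Fin.cons (-y 0) (fun i => y i.succ))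
  rw [lorIP_eq_sum_succ] at this
  rw [eucIP, Fin.sum_univ_succ]
  simp only [Fin.cons_succ, Fin.cons_zero] at this
  linarith

/-- A light-like vector orthogonal to a time-like vector vanishes. -/
lemma eq_zero_of_lorIP_timelike {n : ℕ} {u w : Fin (n + 1) → ℝ} (hu : lorIP u u < 0)
    (huw : lorIP w u = 0) (hw : lorIP w w = 0) : w = 0 := by
  rw [lorIP_eq_sum_succ] at hu huw hw
  have cs := Finset.sum_mul_sq_le_sq_mul_sq Finset.univ (fun i : Fin n => w i.succ)
    (fun i => u i.succ)
  simp only [pow_two] at cs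
  have h0 : w 0 = 0 := by
    by_contra h
    have hpos : 0 < w 0 * w 0 := mul_self_pos.2 h
    rw [sub_eq_zero.1 huw, sub_eq_zero.1 hw] at cs
    nlinarith
  apply eucIP_self_eq_zero
  rw [eucIP, Fin.sum_univ_succ]
  rw [h0] at hw ⊢
  linarith

lemma AEquiv.symm {a b : ℕ} {f g : (Fin a → ℝ) → (Fin b → ℝ)} (e : AEquiv f g) :
    AEquiv g f := by
  obtain ⟨h, H, h1, h2, h3, h4, rfl⟩ := e
  exact ⟨h.symm, H.symm, h2, h1, h4, h3, by funext x; simp⟩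

lemma AEquiv.trans {a b : ℕ} {f g k : (Fin a → ℝ) → (Fin b → ℝ)} (e : AEquiv f g)
    (e' : AEquiv g k) : AEquiv f k := by
  obtain ⟨h, H, h1, h2, h3, h4, rfl⟩ := e
  obtain ⟨h', H', h1', h2', h3', h4', rfl⟩ := e'
  exact ⟨h'.trans h, H.trans H', h1.comp h1', h2'.comp h2, h3'.comp h3, h4.comp h4', rfl⟩

/-- The definite fold `(y₀, y₁, …, yₙ) ↦ (y₀², y₁, …, yₙ)`. -/
def definiteFold (n : ℕ) (y : Fin (n + 1) → ℝ) : Fin (n + 1) → ℝ :=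
  Fin.cons (y 0 ^ 2) (fun i : Fin n => y i.succ)

lemma definiteFold_fiber {n : ℕ} {x y z : Fin (n + 1) → ℝ}
    (hxy : definiteFold n x = definiteFold n y) (hxz : definiteFold n x = definiteFold n z) :
    x = y ∨ x = z ∨ y = z := by
  have key : ∀ {a b : Fin (n + 1) → ℝ}, definiteFold n a = definiteFold n b →
      a 0 ^ 2 = b 0 ^ 2 ∧ (a 0 = b 0 → a = b) := by
    intro a b hab
    refine ⟨by simpa [definiteFold] using congrFun hab 0, fun h0 => ?_⟩
    funext i
    refine Fin.cases h0 (fun i => ?_) i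
    simpa [definiteFold] using congrFun hab i.succ
  obtain ⟨h1, h1'⟩ := key hxy
  obtain ⟨h2, h2'⟩ := key hxz
  obtain ⟨-, h3'⟩ := key (hxy.symm.trans hxz)
  rcases sq_eq_sq_iff_eq_or_eq_neg.1 h1 with h | h
  · exact Or.inl (h1' h)
  rcases sq_eq_sq_iff_eq_or_eq_neg.1 h2 with h' | h'
  · exact Or.inr (Or.inl (h2' h'))
  · exact Or.inr (Or.inr (h3' (by linarith)))

lemma AEquiv.fiber_of_definiteFold {n : ℕ} {f : (Fin (n + 1) → ℝ) → (Fin (n + 1) → ℝ)}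
    (e : AEquiv (definiteFold n) f) {x y z : Fin (n + 1) → ℝ} (hxy : f x = f y)
    (hxz : f x = f z) : x = y ∨ x = z ∨ y = z := by
  obtain ⟨h, H, -, -, -, -, rfl⟩ := e
  simpa using definiteFold_fiber (H.injective hxy) (H.injective hxz)

lemma recSub_eq_span_succ {n k : ℕ} (p : Fin (k + 1) → Fin (n + 1) → ℝ) :
    recSub p = Submodule.span ℝ (Set.range fun i : Fin k => p i.succ - p 0) := by
  apply le_antisymm
  · refine Submodule.span_le.2 ?_
    rintro _ ⟨i, rfl⟩
    refine Fin.cases ?_ (fun i => ?_) i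
    · simp
    · exact Submodule.subset_span ⟨i, rfl⟩
  · exact Submodule.span_mono (by rintro _ ⟨i, rfl⟩; exact ⟨i.succ, rfl⟩)

/-- The distance-squared mapping of a nondegenerate symmetric form whose recognition subspace is a nondegenerate
hyperplane is `𝒜`-equivalent to the definite fold. -/
theorem aequiv_definiteFold {n : ℕ} (B : LinearMap.BilinForm ℝ (Fin (n + 1) → ℝ))
    (hsymm : ∀ x y, B x y = B y x) (hB : ∀ y, (∀ x, B x y = 0) → y = 0)
    (p : Fin (n + 1) → Fin (n + 1) → ℝ) (hgen : Module.finrank ℝ (recSub p) = n)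
    (hV : ∀ w ∈ recSub p, (∀ v ∈ recSub p, B w v = 0) → w = 0) :
    AEquiv (definiteFold n) (fun x i => B (x - p i) (x - p i)) := by
  set v : Fin n → Fin (n + 1) → ℝ := fun i => p i.succ - p 0 with hv
  rw [recSub_eq_span_succ, ← hv] at hgen hV
  have hli : LinearIndependent ℝ v := by
    rw [linearIndependent_iff_card_eq_finrank_span]
    simpa [Set.finrank] using hgen.symm
  obtain ⟨w, hwv, hw0⟩ : ∃ w : Fin (n + 1) → ℝ, (∀ i, B (v i) w = 0) ∧ w ≠ 0 := by
    obtain ⟨w, hw, hw0⟩ := (Submodule.ne_bot_iff _).1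
      (LinearMap.ker_ne_bot_of_finrank_lt (f := LinearMap.pi fun i => B (v i)) (by simp))
    exact ⟨w, fun i => congrFun hw i, hw0⟩
  have hwV : ∀ x ∈ Submodule.span ℝ (Set.range v), B x w = 0 := fun x hx => by
    have hle : Submodule.span ℝ (Set.range v) ≤ LinearMap.ker (B.flip w) :=
      Submodule.span_le.2 (by rintro _ ⟨i, rfl⟩; exact hwv i)
    exact hle hx
  let u : Fin (n + 1) → Fin (n + 1) → ℝ := Fin.cons w v
  have huli : LinearIndependent ℝ u :=
    linearIndependent_finCons.2
      ⟨hli, fun hw => hw0 (hV w hw fun x hx => (hsymm w x).trans (hwV x hx))⟩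
  have hspan : Submodule.span ℝ (Set.range u) = ⊤ :=
    huli.span_eq_top_of_card_eq_finrank (by simp)
  have hzero : ∀ y, (∀ i, B (u i) y = 0) → y = 0 := fun y hy => hB y fun x => by
    have hle : Submodule.span ℝ (Set.range u) ≤ LinearMap.ker (B.flip y) :=
      Submodule.span_le.2 (by rintro _ ⟨i, rfl⟩; exact hy i)
    exact hle (hspan ▸ Submodule.mem_top)
  have hww : B w w ≠ 0 := fun h => hw0 (hzero w (Fin.cases h hwv))
  let φ : (Fin (n + 1) → ℝ) ≃ₗ[ℝ] (Fin (n + 1) → ℝ) :=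
    LinearEquiv.ofInjectiveEndo (LinearMap.pi fun i => B (u i))
      ((injective_iff_map_eq_zero _).2 fun y hy => hzero y fun i => congrFun hy i)
  have hφ : ∀ y i, φ y i = B (u i) y := fun _ _ => rfl
  have hφsymm : ContDiff ℝ (⊤ : ℕ∞) φ.symm :=
    φ.symm.toContinuousLinearEquiv.contDiff
  have hBdiff : ContDiff ℝ (⊤ : ℕ∞) (fun x : Fin (n + 1) → ℝ => B x x) := by
    have hB' : (fun x : Fin (n + 1) → ℝ => B x x) = fun x =>
        LinearMap.toContinuousLinearMap (LinearMap.toContinuousLinearMap.toLinearMap ∘ₗ B) x x :=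
      rfl
    rw [hB']
    exact (ContinuousLinearMap.contDiff _).clm_apply contDiff_id
  -- The square of the component along the recognition subspace, in terms of its coordinates.
  let q : (Fin n → ℝ) → ℝ := fun ζ => B (φ.symm (Fin.cons 0 ζ)) (φ.symm (Fin.cons 0 ζ))
  have hcons : ContDiff ℝ (⊤ : ℕ∞) (fun ζ : Fin n → ℝ => (Fin.cons 0 ζ : Fin (n + 1) → ℝ)) := by
    rw [contDiff_pi]
    intro i
    refine Fin.cases ?_ (fun i => ?_) i
    · simpa using contDiff_const
    · simpa using contDiff_apply ℝ ℝ i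
  have hq : ContDiff ℝ (⊤ : ℕ∞) q := hBdiff.comp (hφsymm.comp hcons)
  have hsq : ∀ y, B y y = q (fun i => B (v i) y) + B w y ^ 2 / B w w := by
    intro y
    have hdec : φ.symm (Fin.cons 0 fun i => B (v i) y) = y - (B w y / B w w) • w := by
      rw [LinearEquiv.symm_apply_eq]
      funext i
      rw [hφ]
      refine Fin.cases ?_ (fun i => ?_) i
      · simp [u, hww]
      · simp [u, hwv]
    simp only [q, hdec, map_sub, map_smul, LinearMap.sub_apply, LinearMap.smul_apply, smul_eq_mul,
      hsymm y w]
    field_simp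
    ring
  let h : (Fin (n + 1) → ℝ) ≃ (Fin (n + 1) → ℝ) :=
    (Equiv.subRight (p 0)).trans φ.toEquiv
  let G : (Fin (n + 1) → ℝ) → (Fin (n + 1) → ℝ) := fun s =>
    Fin.cons (q (Fin.tail s) + s 0 / B w w) fun i : Fin n =>
      q (Fin.tail s) + s 0 / B w w - 2 * s i.succ + B (v i) (v i)
  let K : (Fin (n + 1) → ℝ) → (Fin n → ℝ) := fun a i => (a 0 - a i.succ + B (v i) (v i)) / 2
  let G' : (Fin (n + 1) → ℝ) → (Fin (n + 1) → ℝ) := fun a =>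
    Fin.cons (B w w * (a 0 - q (K a))) (K a)
  let H : (Fin (n + 1) → ℝ) ≃ (Fin (n + 1) → ℝ) :=
    { toFun := G
      invFun := G'
      left_inv := fun s => by
        have hK : K (G s) = Fin.tail s := by
          funext i
          simp only [K, G, Fin.tail, Fin.cons_zero, Fin.cons_succ]
          ring
        funext i
        refine Fin.cases ?_ (fun i => ?_) i
        · simp only [G', hK, Fin.cons_zero]
          simp only [G, Fin.cons_zero]
          field_simp
          ring
        · simp [G', hK, Fin.tail]
      right_inv := fun a => by
        have hK : Fin.tail (G' a) = K a := by simp [G']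
        have h0 : q (K a) + G' a 0 / B w w = a 0 := by
          simp only [G', Fin.cons_zero]
          field_simp
          ring
        funext i
        refine Fin.cases ?_ (fun i => ?_) i
        · simp only [G, hK, Fin.cons_zero, h0]
        · simp only [G, hK, Fin.cons_succ, h0]
          simp only [G', K, Fin.cons_succ]
          ring }
  have htail : ContDiff ℝ (⊤ : ℕ∞) (fun s : Fin (n + 1) → ℝ => (Fin.tail s : Fin n → ℝ)) :=
    contDiff_pi.2 fun i => contDiff_apply ℝ ℝ i.succ
  have hK : ContDiff ℝ (⊤ : ℕ∞) K := contDiff_pi.2 fun i => by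
    simp only [K]
    fun_prop
  have hqt := hq.comp htail
  have hqK := hq.comp hK
  refine ⟨h, H, ?_, ?_, ?_, ?_, ?_⟩
  · exact φ.toContinuousLinearEquiv.contDiff.comp (contDiff_id.sub contDiff_const)
  · exact hφsymm.add contDiff_const
  · refine contDiff_pi.2 fun i => ?_
    have h0 : ContDiff ℝ (⊤ : ℕ∞) fun s : Fin (n + 1) → ℝ => q (Fin.tail s) + s 0 / B w w :=
      hqt.add ((contDiff_apply ℝ ℝ 0).div_const _)
    refine Fin.cases ?_ (fun i => ?_) i
    · simpa [H, G] using h0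
    · simpa [H, G] using
        (h0.sub (contDiff_const.mul (contDiff_apply ℝ ℝ i.succ))).add contDiff_const
  · refine contDiff_pi.2 fun i => ?_
    refine Fin.cases ?_ (fun i => ?_) i
    · simpa [H, G'] using contDiff_const.mul ((contDiff_apply ℝ ℝ 0).sub hqK)
    · simpa [H, G'] using contDiff_pi.1 hK i
  · funext x i
    have ht : Fin.tail (definiteFold n (h x)) = fun i => B (v i) (x - p 0) := rfl
    have h0 : definiteFold n (h x) 0 = B w (x - p 0) ^ 2 := rfl
    have hs : ∀ i : Fin n, definiteFold n (h x) i.succ = B (v i) (x - p 0) := fun _ => rfl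
    have hG : ∀ y, H y = G y := fun _ => rfl
    simp only [Function.comp_apply, hG, G, ht, h0, hs, ← hsq]
    refine Fin.cases ?_ (fun i => ?_) i
    · simp
    · have hx : x - p i.succ = (x - p 0) - v i := by simp [hv]
      simp only [Fin.cons_succ, hx]
      generalize x - p 0 = y
      simp only [map_sub, LinearMap.sub_apply, hsymm y (v i)]
      ring

/-- The Lorentzian distance-squared mapping is constant on the line through `p 0` in a direction
lying in the radical of the recognition subspace. -/
lemma LorDSM_add_smul {n m : ℕ} (p : Fin (m + 1) → Fin (n + 1) → ℝ) {w : Fin (n + 1) → ℝ}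
    (hw : w ∈ recSub p) (horth : ∀ v ∈ recSub p, lorIP w v = 0) (t : ℝ) :
    LorDSM p (p 0 + t • w) = LorDSM p (p 0) := by
  funext i
  have h1 := horth w hw
  have h2 : lorIP w (p i - p 0) = 0 := horth _ (Submodule.subset_span ⟨i, rfl⟩)
  have h3 := (lorIP_comm (p i - p 0) w).trans h2
  have e1 : p 0 + t • w - p i = t • w - (p i - p 0) := by abel
  have e2 : p 0 - p i = -(p i - p 0) := by abel
  simp only [LorDSM, e1, e2]
  rw [← lorForm_apply] at h1 h2 h3 ⊢
  simp only [map_sub, map_smul, map_neg, LinearMap.sub_apply, LinearMap.smul_apply, smul_eq_mul,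
    LinearMap.neg_apply, ← lorForm_apply] at h1 h2 h3 ⊢
  linear_combination t ^ 2 * h1 - t * h2 - t * h3

lemma exists_null_orthogonal_of_lightLike {n : ℕ} {V : Submodule ℝ (Fin (n + 1) → ℝ)}
    (hV : LLightLike V) : ∃ w ∈ V, w ≠ 0 ∧ ∀ v ∈ V, lorIP w v = 0 := by
  obtain ⟨ht, hs⟩ := hV
  simp only [LTimeLike, LSpaceLike] at ht hs
  push Not at ht hs
  obtain ⟨w, hwV, hw0, hw⟩ := hs
  refine ⟨w, hwV, hw0, fun v hv => ?_⟩
  have hpos : ∀ t : ℝ, 0 ≤ lorIP w w + 2 * t * lorIP w v + t ^ 2 * lorIP v v := fun t => by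
    have := ht (w + t • v) (V.add_mem hwV (V.smul_mem t hv))
    have hc := lorIP_comm v w
    rw [← lorForm_apply] at this hc
    simp only [map_add, map_smul, LinearMap.add_apply, LinearMap.smul_apply, smul_eq_mul,
      ← lorForm_apply] at this hc ⊢
    linear_combination this + t * hc
  have hww : lorIP w w = 0 := le_antisymm hw (ht w hwV)
  have := discrim_le_zero (a := lorIP v v) (b := 2 * lorIP w v) (c := lorIP w w)
    (fun t => by have := hpos t; linarith)
  rw [discrim, hww] at this
  nlinarith

theorem corollary2_2 (n : ℕ) (hn : 1 ≤ n)
    (p : Fin (n + 1) → Fin (n + 1) → ℝ)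
    (hgen : Module.finrank ℝ (recSub p) = n) :
    AEquiv (LorDSM p) (EucDSM p)
      ↔ (LTimeLike (recSub p) ∨ LSpaceLike (recSub p)) := by
  have hE : AEquiv (definiteFold n) (EucDSM p) :=
    aequiv_definiteFold (eucForm (n + 1)) eucIP_comm (fun y hy => eucIP_self_eq_zero (hy y)) p hgen
      (fun w hw h => eucIP_self_eq_zero (h w hw))
  constructor
  · intro e
    by_contra hV
    obtain ⟨w, hwV, hw0, horth⟩ :=
      exists_null_orthogonal_of_lightLike (V := recSub p) (not_or.1 hV)
    have hL : AEquiv (definiteFold n) (LorDSM p) := hE.trans e.symm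
    have hline := LorDSM_add_smul p hwV horth
    have := hL.fiber_of_definiteFold ((hline 0).trans (hline 1).symm)
      ((hline 0).trans (hline 2).symm)
    simp only [add_right_inj, (smul_left_injective ℝ hw0).eq_iff] at this
    norm_num at this
  · intro hV
    refine AEquiv.trans (AEquiv.symm ?_) hE
    refine aequiv_definiteFold (lorForm n) lorIP_comm
      (fun y hy => eq_zero_of_forall_lorIP_eq_zero hy) p hgen (fun w hw h => ?_)
    rcases hV with ⟨u, hu, huu⟩ | hs
    · exact eq_zero_of_lorIP_timelike huu (h u hu) (h w hw)
    · by_contra hw0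
      exact (hs w hw hw0).ne (h w hw).symm
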